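/- The inclusion-maximal bounded cells of the tropical complex 𝒞_V of the tropical matroid polytope P are exactly the sets tconv{0, e_{i_1}, e_{i_1,i_2}, …, e_{i_1,…,i_{d−k+1}}} over all valid sequences i_1,…,i_{d−k+1} of length d−k+1 (so that [d+1]∖{i_1,…,i_{d−k+1}} is a basis of 𝓜), and each such cell has dimension d−k+1. -/

import Mathlib

open Finset

noncomputable section

variable {d n : ℕ}

/-- `x ∈ tconv {v i}`, at the level of representatives in `ℝ^{d+1}` modulo constants. -/
def InTconv {ι : Type*} (v : ι → Fin (d + 1) → ℝ) (x : Fin (d + 1) → ℝ) : Prop :=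
  ∃ (lam : ι → ℝ) (c : ℝ), ∀ j, x j + c = ⨅ i, (lam i + v i j)

/-- the `k`-th entry of the type of `x` with respect to the generators `v` -/
def typeEntry {ι : Type*} (v : ι → Fin (d + 1) → ℝ) (x : Fin (d + 1) → ℝ)
    (k : Fin (d + 1)) : Set ι :=
  {i | v i k - x k = ⨅ j, (v i j - x j)}

/-- the spanning subgraph of `G` whose edges are those indexed by `B` -/
def edgeGraph {W : Type*} (G : SimpleGraph W) (ε : Fin (d + 1) ≃ G.edgeSet)
    (B : Finset (Fin (d + 1))) : SimpleGraph W :=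
  SimpleGraph.fromEdgeSet {s | ∃ i ∈ B, (ε i : Sym2 W) = s}

/-- `B ⊆ [d+1]` is the edge set of a spanning tree of `G` -/
def IsSpanningTreeEdges {W : Type*} (G : SimpleGraph W) (ε : Fin (d + 1) ≃ G.edgeSet)
    (B : Finset (Fin (d + 1))) : Prop :=
  (edgeGraph G ε B).IsTree

/-- generators of the tropical matroid polytope, in canonical coordinates -/
def gen (Bs : Fin n → Finset (Fin (d + 1))) (l : Fin n) (i : Fin (d + 1)) : ℝ :=
  if i ∈ Bs l then 0 else 1

/-- data of the cycle matroid of a connected bridgeless simple graph `G` whose `d+1` edges are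
enumerated by `ε` and whose bases (spanning-tree edge sets, each of rank/cardinality `k`) are
enumerated without repetition by `Bs`. -/
structure MatroidData (d n k : ℕ) (W : Type) (G : SimpleGraph W)
    (ε : Fin (d + 1) ≃ G.edgeSet) (Bs : Fin n → Finset (Fin (d + 1))) : Prop where
  connected : G.Connected
  bridgeless : ∀ i : Fin (d + 1), ¬ G.IsBridge (ε i : Sym2 W)
  tree : ∀ l, IsSpanningTreeEdges G ε (Bs l)
  inj : Function.Injective Bs
  all : ∀ B : Finset (Fin (d + 1)), IsSpanningTreeEdges G ε B → ∃ l, Bs l = B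
  card : ∀ l, (Bs l).card = k

/-- minimum of `f` over a subset of coordinates (as an infimum) -/
def tmin (I : Set (Fin (d + 1))) (f : Fin (d + 1) → ℝ) : ℝ := sInf (f '' I)

/-- the closed tropical halfspace with apex `p` and type `I` -/
def Halfspace (p : Fin (d + 1) → ℝ) (I : Set (Fin (d + 1))) : Set (Fin (d + 1) → ℝ) :=
  {x | tmin I (fun i => x i - p i) ≤ tmin Iᶜ (fun j => x j - p j)}

/-- the closed cell of the tropical complex containing `p` -/
def closedCell {ι : Type*} (v : ι → Fin (d + 1) → ℝ) (p : Fin (d + 1) → ℝ) :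
    Set (Fin (d + 1) → ℝ) :=
  {x | ∀ k, typeEntry v p k ⊆ typeEntry v x k}

/-- the (closed) cells of the tropical complex `𝒞_V` -/
def IsCell {ι : Type*} (v : ι → Fin (d + 1) → ℝ) (X : Set (Fin (d + 1) → ℝ)) : Prop :=
  ∃ p, X = closedCell v p

/-- the chart `c₀ : 𝕋^d → ℝ^d` -/
def chart (x : Fin (d + 1) → ℝ) (i : Fin d) : ℝ := x i.succ - x 0

/-- a bounded cell of the tropical complex (bounded as a subset of `𝕋^d ≅ ℝ^d`) -/
def IsBoundedCell {ι : Type*} (v : ι → Fin (d + 1) → ℝ) (X : Set (Fin (d + 1) → ℝ)) : Prop :=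
  IsCell v X ∧ Bornology.IsBounded (chart '' X)

/-- an inclusion-maximal bounded cell -/
def IsMaxBoundedCell {ι : Type*} (v : ι → Fin (d + 1) → ℝ) (X : Set (Fin (d + 1) → ℝ)) : Prop :=
  IsBoundedCell v X ∧ ∀ Y, IsBoundedCell v Y → X ⊆ Y → Y = X

/-- an inclusion-maximal cell -/
def IsMaxCell {ι : Type*} (v : ι → Fin (d + 1) → ℝ) (X : Set (Fin (d + 1) → ℝ)) : Prop :=
  IsCell v X ∧ ∀ Y, IsCell v Y → X ⊆ Y → Y = X

/-- a point of the relative interior of a cell `X`: a point of `X` whose type is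
componentwise contained in the type of every point of `X` -/
def IsInteriorPoint {ι : Type*} (v : ι → Fin (d + 1) → ℝ) (X : Set (Fin (d + 1) → ℝ))
    (x : Fin (d + 1) → ℝ) : Prop :=
  x ∈ X ∧ ∀ y ∈ X, ∀ k, typeEntry v x k ⊆ typeEntry v y k

/-- `b_{I,J}`: the number of bases `B` with `I ⊆ B` and `J ∩ B = ∅` -/
def bIJ (Bs : Fin n → Finset (Fin (d + 1))) (I J : Finset (Fin (d + 1))) : ℕ :=
  (Finset.univ.filter fun l => I ⊆ Bs l ∧ Disjoint J (Bs l)).card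

/-- a pseudovertex of the tropical complex: the unique point of `𝕋^d` of its type -/
def IsPseudovertex {ι : Type*} (v : ι → Fin (d + 1) → ℝ) (x : Fin (d + 1) → ℝ) : Prop :=
  ∀ y, (∀ k, typeEntry v y k = typeEntry v x k) → ∃ c : ℝ, y = fun j => x j + c

/-- the pseudovertex `e_{i₁,…,i_s} = -e_J`, `J = [d+1] ∖ {σ 0,…,σ (s-1)}`, in canonical
coordinates: coordinate `1` at `σ 0, …, σ (s-1)` and `0` elsewhere -/
def ptSeq {r : ℕ} (σ : Fin r → Fin (d + 1)) (s : ℕ) (j : Fin (d + 1)) : ℝ :=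
  if ∃ t : Fin r, (t : ℕ) < s ∧ σ t = j then 1 else 0

/-- the generators `-e_I`, `|I| = k`, of the tropical hypersimplex `Δ_k^d`, in
canonical coordinates -/
def genU (d k : ℕ) : {I : Finset (Fin (d + 1)) // I.card = k} → Fin (d + 1) → ℝ :=
  fun I j => if j ∈ I.1 then 0 else 1

/-! ### Types and cells -/

section Cells

variable {ι : Type*} {v : ι → Fin (d + 1) → ℝ} {x y p q : Fin (d + 1) → ℝ} {i : ι}

lemma mem_typeEntry_iff {k : Fin (d + 1)} :
    i ∈ typeEntry v x k ↔ ∀ j, v i k - x k ≤ v i j - x j := by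
  refine ⟨fun h j => ?_, fun h => ?_⟩
  · change v i k - x k = _ at h
    rw [h]
    exact ciInf_le (Set.finite_range _).bddBelow j
  · exact le_antisymm (le_ciInf h) (ciInf_le (Set.finite_range _).bddBelow k)

lemma closedCell_subset_of_mem (h : p ∈ closedCell v q) : closedCell v p ⊆ closedCell v q :=
  fun _ hx k => (h k).trans (hx k)

lemma self_mem_closedCell : p ∈ closedCell v p := fun _ => subset_rfl

/-- Decreasing a coordinate whose type entry is empty does not leave the cell. -/
lemma sub_single_mem_closedCell {k : Fin (d + 1)} (hk : typeEntry v p k = ∅) {s : ℝ}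
    (hs : 0 ≤ s) : p - Pi.single k s ∈ closedCell v p := by
  intro j i hi
  have hjk : j ≠ k := by
    rintro rfl
    simp [hk] at hi
  rw [mem_typeEntry_iff] at hi ⊢
  intro a
  have ha := hi a
  rcases eq_or_ne a k with rfl | hak
  · simp only [Pi.sub_apply, Pi.single_eq_same, Pi.single_eq_of_ne hjk]
    linarith
  · simpa only [Pi.sub_apply, Pi.single_eq_of_ne hak, Pi.single_eq_of_ne hjk, sub_zero] using ha

/-- The types of the points of a bounded cell have no empty entry. -/
lemma typeEntry_nonempty_of_isBounded (hd : 1 ≤ d)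
    (hb : Bornology.IsBounded (chart '' closedCell v p)) (k : Fin (d + 1)) :
    (typeEntry v p k).Nonempty := by
  by_contra hk
  rw [Set.not_nonempty_iff_eq_empty] at hk
  obtain ⟨C, hC⟩ := hb.exists_norm_le
  have key : ∀ (s : ℝ) (a : Fin d), 0 ≤ s → |chart (p - Pi.single k s) a| ≤ C := fun s a hs =>
    (norm_le_pi_norm (chart (p - Pi.single k s)) a).trans
      (hC _ ⟨_, sub_single_mem_closedCell hk hs, rfl⟩)
  rcases Fin.eq_zero_or_eq_succ k with rfl | ⟨a, rfl⟩
  · let a : Fin d := ⟨0, hd⟩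
    have h := key (|chart p a| + |C| + 1) a (by positivity)
    simp only [chart, Pi.sub_apply, Pi.single_eq_same, Pi.single_eq_of_ne (Fin.succ_ne_zero a)] at h
    have := abs_le.1 h
    grind
  · have h := key (|chart p a| + |C| + 1) a (by positivity)
    simp only [chart, Pi.sub_apply, Pi.single_eq_same,
      Pi.single_eq_of_ne (Fin.succ_ne_zero a).symm] at h
    have := abs_le.1 h
    grind

end Cells

/-! ### Chain simplices -/

section Chain

variable {r : ℕ} {σ τ : Fin r → Fin (d + 1)} {x : Fin (d + 1) → ℝ}

/-- The points which, up to a common shift, take values in `[0, 1]`, vanish outside the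
image of `σ` and decrease along `σ`. -/
def chainSimplex (σ : Fin r → Fin (d + 1)) : Set (Fin (d + 1) → ℝ) :=
  {x | ∃ c, (∀ j ∉ Set.range σ, x j = c) ∧ (∀ t, c ≤ x (σ t) ∧ x (σ t) ≤ c + 1) ∧
    Antitone (x ∘ σ)}

/-- A generic point of `chainSimplex σ`. -/
def chainPoint (σ : Fin r → Fin (d + 1)) (j : Fin (d + 1)) : ℝ :=
  ∑ t : Fin r, if σ t = j then ((r : ℝ) - t) / (r + 1) else 0

lemma chainPoint_apply (hσ : Function.Injective σ) (t : Fin r) :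
    chainPoint σ (σ t) = ((r : ℝ) - t) / (r + 1) := by
  simp [chainPoint, hσ.eq_iff]

lemma chainPoint_of_notMem {j : Fin (d + 1)} (hj : j ∉ Set.range σ) : chainPoint σ j = 0 :=
  Finset.sum_eq_zero fun t _ => if_neg fun h => hj ⟨t, h⟩

lemma chainPoint_pos (hσ : Function.Injective σ) (t : Fin r) : 0 < chainPoint σ (σ t) := by
  rw [chainPoint_apply hσ]
  have : ((t : ℕ) : ℝ) < r := by exact_mod_cast t.2
  exact div_pos (by linarith) (by positivity)

lemma chainPoint_strictAnti (hσ : Function.Injective σ) : StrictAnti (chainPoint σ ∘ σ) := by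
  intro s t hst
  simp only [Function.comp_apply, chainPoint_apply hσ]
  have : ((s : ℕ) : ℝ) < (t : ℕ) := by exact_mod_cast hst
  gcongr

lemma chainPoint_nonneg (hσ : Function.Injective σ) (j : Fin (d + 1)) : 0 ≤ chainPoint σ j := by
  by_cases hj : j ∈ Set.range σ
  · obtain ⟨t, rfl⟩ := hj
    exact (chainPoint_pos hσ t).le
  · exact (chainPoint_of_notMem hj).ge

lemma chainPoint_lt_one (hσ : Function.Injective σ) (j : Fin (d + 1)) : chainPoint σ j < 1 := by
  by_cases hj : j ∈ Set.range σ
  · obtain ⟨t, rfl⟩ := hj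
    rw [chainPoint_apply hσ, div_lt_one (by positivity)]
    have : (0 : ℝ) ≤ (t : ℕ) := by positivity
    linarith
  · rw [chainPoint_of_notMem hj]
    exact one_pos

lemma chainPoint_mem_chainSimplex (hσ : Function.Injective σ) :
    chainPoint σ ∈ chainSimplex σ :=
  ⟨0, fun _ hj => chainPoint_of_notMem hj,
    fun t => ⟨chainPoint_nonneg hσ _, by linarith [chainPoint_lt_one hσ (σ t)]⟩,
    (chainPoint_strictAnti hσ).antitone⟩

/-- A chain simplex determines its sequence. -/
lemma eq_of_chainPoint_mem (hσ : Function.Injective σ) (hτ : Function.Injective τ)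
    (hne : ∃ j, j ∉ Set.range τ) (h : chainPoint σ ∈ chainSimplex τ) : σ = τ := by
  obtain ⟨c, hout, hin, hanti⟩ := h
  have hrσ : (univ.image σ).card = r := by simp [card_image_of_injective _ hσ]
  have hrτ : (univ.image τ).card = r := by simp [card_image_of_injective _ hτ]
  have hlt : r < d + 1 := by
    obtain ⟨j, hj⟩ := hne
    have : univ.image τ ⊂ univ := by
      refine (ssubset_univ_iff).2 fun h => hj ?_
      have := h ▸ mem_univ j
      simpa using this
    simpa [hrτ] using card_lt_card this
  have hc : c = 0 := by
    obtain ⟨j, hj⟩ : ∃ j, j ∉ Set.range σ := by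
      by_contra! hall
      have : univ.image σ = univ := by
        ext j
        simpa using hall j
      rw [this] at hrσ
      simp at hrσ
      omega
    have hle : c ≤ chainPoint σ j := by
      by_cases hj' : j ∈ Set.range τ
      · obtain ⟨t, rfl⟩ := hj'
        exact (hin t).1
      · exact (hout j hj').ge
    obtain ⟨j', hj'⟩ := hne
    have := hout j' hj' ▸ chainPoint_nonneg hσ j'
    rw [chainPoint_of_notMem hj] at hle
    exact le_antisymm hle this
  have hsub : univ.image σ ⊆ univ.image τ := by
    intro j hj
    obtain ⟨t, -, rfl⟩ := mem_image.1 hj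
    by_contra hj'
    have := hout (σ t) (by simpa using hj')
    have := chainPoint_pos hσ t
    linarith
  have heq := eq_of_subset_of_card_le hsub (hrτ.trans hrσ.symm).le
  have hrange : Set.range σ = Set.range τ := by
    simpa using congrArg (fun s : Finset (Fin (d + 1)) => (s : Set (Fin (d + 1)))) heq
  have hinj : Set.InjOn (chainPoint σ) (Set.range σ) := by
    rintro _ ⟨s, rfl⟩ _ ⟨t, rfl⟩ hst
    exact congrArg σ ((chainPoint_strictAnti hσ).injective hst)
  have hτmem : ∀ t, τ t ∈ Set.range σ := fun t => hrange ▸ Set.mem_range_self t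
  have hanti' : StrictAnti (chainPoint σ ∘ τ) :=
    hanti.strictAnti_of_injective fun s t hst => hτ (hinj (hτmem s) (hτmem t) hst)
  have hcomp : (fun t => -chainPoint σ (σ t)) = fun t => -chainPoint σ (τ t) := by
    refine (StrictMono.range_inj (chainPoint_strictAnti hσ).neg hanti'.neg).1 ?_
    change Set.range ((fun j => -chainPoint σ j) ∘ σ) = Set.range ((fun j => -chainPoint σ j) ∘ τ)
    rw [Set.range_comp, Set.range_comp, hrange]
  funext t
  exact hinj (Set.mem_range_self t) (hτmem t) (neg_injective (congrFun hcomp t))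

lemma ptSeq_apply (hσ : Function.Injective σ) (s : ℕ) (t : Fin r) :
    ptSeq σ s (σ t) = if (t : ℕ) < s then 1 else 0 := by
  simp [ptSeq, hσ.eq_iff]

lemma ptSeq_of_notMem {j : Fin (d + 1)} (hj : j ∉ Set.range σ) (s : ℕ) : ptSeq σ s j = 0 :=
  if_neg fun ⟨t, _, ht⟩ => hj ⟨t, ht⟩

/-- The tropical convex hull of `0, e_{i₁}, …, e_{i₁,…,i_r}` is the chain simplex. -/
lemma setOf_inTconv_ptSeq (hσ : Function.Injective σ) :
    {x | InTconv (fun s : Fin (r + 1) => ptSeq σ (s : ℕ)) x} = chainSimplex σ := by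
  have bdd : ∀ f : Fin (r + 1) → ℝ, BddBelow (Set.range f) := fun f =>
    (Set.finite_range f).bddBelow
  ext x
  constructor
  · rintro ⟨lam, c, h⟩
    refine ⟨(⨅ s, lam s) - c, fun j hj => ?_, fun t => ?_, fun t t' htt' => ?_⟩
    · have := h j
      simp only [ptSeq_of_notMem hj, add_zero] at this
      linarith
    · have ht := h (σ t)
      simp only [ptSeq_apply hσ] at ht
      constructor
      · have : ⨅ s, lam s ≤ x (σ t) + c := by
          rw [ht]
          refine ciInf_mono (bdd _) fun s => ?_
          split_ifs <;> linarith
        linarith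
      · have : x (σ t) + c - 1 ≤ ⨅ s, lam s := by
          rw [ht]
          refine le_ciInf fun s => ?_
          have := ciInf_le (bdd fun s : Fin (r + 1) => lam s + if (t : ℕ) < s then 1 else 0) s
          split_ifs at this <;> linarith
        linarith
    · have ht := h (σ t)
      have ht' := h (σ t')
      simp only [ptSeq_apply hσ] at ht ht'
      have : x (σ t') + c ≤ x (σ t) + c := by
        rw [ht, ht']
        refine ciInf_mono (bdd _) fun s => ?_
        have : (t : ℕ) ≤ t' := htt'
        gcongr
        split_ifs <;> first | omega | norm_num
      simpa using this
  · rintro ⟨c, hout, hin, hanti⟩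
    refine ⟨fun s => if h : (s : ℕ) < r then x (σ ⟨s, h⟩) else c, 0, fun j => ?_⟩
    have hlast : ¬ ((Fin.last r : Fin (r + 1)) : ℕ) < r := by simp
    by_cases hj : j ∈ Set.range σ
    · obtain ⟨t, rfl⟩ := hj
      simp only [ptSeq_apply hσ, add_zero]
      apply le_antisymm
      · refine le_ciInf fun s => ?_
        by_cases hs : (s : ℕ) < r
        · by_cases hts : (t : ℕ) < s
          · simp only [hs, hts, dite_true, if_true]
            linarith [(hin t).2, (hin ⟨s, hs⟩).1]
          · simp only [hs, hts, dite_true, if_false, add_zero]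
            exact hanti (show (⟨s, hs⟩ : Fin r) ≤ t from not_lt.1 hts)
        · have hts : (t : ℕ) < s := by omega
          simp only [hs, hts, dite_false, if_true]
          exact (hin t).2
      · refine (ciInf_le (bdd _) t.castSucc).trans ?_
        simp
    · simp only [ptSeq_of_notMem hj, add_zero, hout j hj]
      apply le_antisymm
      · refine le_ciInf fun s => ?_
        split_ifs
        · exact (hin _).1
        · exact le_rfl
      · refine (ciInf_le (bdd _) (Fin.last r)).trans ?_
        simp

lemma abs_sub_le_of_mem_chainSimplex (hx : x ∈ chainSimplex σ) (i j : Fin (d + 1)) :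
    |x i - x j| ≤ 1 := by
  obtain ⟨c, hout, hin, -⟩ := hx
  have key : ∀ j, c ≤ x j ∧ x j ≤ c + 1 := by
    intro j
    by_cases hj : j ∈ Set.range σ
    · obtain ⟨t, rfl⟩ := hj
      exact hin t
    · rw [hout j hj]
      constructor <;> linarith
  rw [abs_le]
  constructor <;> linarith [(key i).1, (key i).2, (key j).1, (key j).2]

lemma isBounded_chart_chainSimplex : Bornology.IsBounded (chart '' chainSimplex σ) := by
  refine isBounded_iff_forall_norm_le.2 ⟨1, ?_⟩
  rintro _ ⟨x, hx, rfl⟩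
  exact (pi_norm_le_iff_of_nonneg zero_le_one).2 fun i => abs_sub_le_of_mem_chainSimplex hx _ _

/-- `chart` as a linear map. -/
def chartLinearMap (d : ℕ) : (Fin (d + 1) → ℝ) →ₗ[ℝ] (Fin d → ℝ) where
  toFun := chart
  map_add' x y := by
    ext i
    simp only [chart, Pi.add_apply]
    ring
  map_smul' a x := by
    ext i
    simp only [chart, Pi.smul_apply, smul_eq_mul, RingHom.id_apply]
    ring

/-- The set of antitone sequences in `[0, 1]` spans. -/
lemma vectorSpan_antitone_eq_top (r : ℕ) :
    vectorSpan ℝ {y : Fin r → ℝ | (∀ t, 0 ≤ y t ∧ y t ≤ 1) ∧ Antitone y} = ⊤ := by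
  rw [eq_top_iff, ← (Pi.basisFun ℝ (Fin r)).span_eq, Submodule.span_le]
  rintro _ ⟨t, rfl⟩
  have h : (Pi.basisFun ℝ (Fin r)) t =
      (fun s => if s ≤ t then (1 : ℝ) else 0) -ᵥ (fun s => if s < t then (1 : ℝ) else 0) := by
    ext s
    rcases lt_trichotomy s t with hs | rfl | hs
    · simp [hs, hs.le, hs.ne]
    · simp
    · simp [hs.not_ge, hs.not_gt, hs.ne']
  rw [h]
  apply vsub_mem_vectorSpan
  · exact ⟨fun s => by dsimp only; split_ifs <;> norm_num, fun a b hab => by grind⟩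
  · exact ⟨fun s => by dsimp only; split_ifs <;> norm_num, fun a b hab => by grind⟩

lemma finrank_vectorSpan_chart_chainSimplex (hσ : Function.Injective σ)
    (hne : ∃ j, j ∉ Set.range σ) :
    Module.finrank ℝ (vectorSpan ℝ (chart '' chainSimplex σ)) = r := by
  obtain ⟨j₀, hj₀⟩ := hne
  let E : (Fin r → ℝ) →ₗ[ℝ] (Fin (d + 1) → ℝ) := Function.ExtendByZero.linearMap ℝ σ
  have hEσ : ∀ y t, E y (σ t) = y t := fun y t => hσ.extend_apply y 0 t
  have hEout : ∀ y j, j ∉ Set.range σ → E y j = 0 := fun y j hj =>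
    Function.extend_apply' _ _ _ hj
  let L := chartLinearMap d ∘ₗ E
  have hinj : Function.Injective L := by
    refine (injective_iff_map_eq_zero L).2 fun y hy => ?_
    have hconst : ∀ j, E y j = E y 0 := by
      intro j
      rcases Fin.eq_zero_or_eq_succ j with rfl | ⟨a, rfl⟩
      · rfl
      · exact sub_eq_zero.1 (congrFun hy a)
    ext t
    rw [← hEσ y t, hconst, ← hconst j₀, hEout y j₀ hj₀]
    rfl
  have himage : chart '' chainSimplex σ =
      L.toAffineMap '' {y : Fin r → ℝ | (∀ t, 0 ≤ y t ∧ y t ≤ 1) ∧ Antitone y} := by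
    ext z
    constructor
    · rintro ⟨x, ⟨c, hout, hin, hanti⟩, rfl⟩
      have hx : ∀ j, E (fun t => x (σ t) - c) j = x j - c := by
        intro j
        by_cases hj : j ∈ Set.range σ
        · obtain ⟨t, rfl⟩ := hj
          exact hEσ _ t
        · rw [hEout _ j hj, hout j hj, sub_self]
      refine ⟨fun t => x (σ t) - c, ⟨fun t => ?_, fun s t hst => ?_⟩, ?_⟩
      · constructor <;> linarith [(hin t).1, (hin t).2]
      · exact sub_le_sub_right (hanti hst) c
      · ext a
        change E _ a.succ - E _ 0 = x a.succ - x 0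
        rw [hx, hx]
        ring
    · rintro ⟨y, ⟨hy, hanti⟩, rfl⟩
      refine ⟨E y, ⟨0, hEout y, fun t => ?_, fun s t hst => ?_⟩, rfl⟩
      · rw [hEσ, zero_add]
        exact hy t
      · simp only [Function.comp_apply, hEσ]
        exact hanti hst
  rw [himage, ← AffineMap.map_vectorSpan, vectorSpan_antitone_eq_top,
    Submodule.map_top]
  change Module.finrank ℝ (LinearMap.range L) = r
  rw [LinearMap.finrank_range_of_inj hinj, Module.finrank_fin_fun]

end Chain

/-! ### Bases of the cycle matroid -/

section Bases

variable {k : ℕ} {W : Type} {G : SimpleGraph W} {ε : Fin (d + 1) ≃ G.edgeSet}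
  {Bs : Fin n → Finset (Fin (d + 1))}

lemma edgeSet_edgeGraph (I : Finset (Fin (d + 1))) :
    (edgeGraph G ε I).edgeSet = (fun i => (ε i : Sym2 W)) '' I := by
  rw [edgeGraph, SimpleGraph.edgeSet_fromEdgeSet, sdiff_eq_left.2]
  · rfl
  · rw [Set.disjoint_left]
    rintro _ ⟨i, -, rfl⟩
    exact G.not_isDiag_of_mem_edgeSet (ε i).2

/-- A simple graph with at most two edges has no cycle. -/
lemma isAcyclic_edgeGraph (I : Finset (Fin (d + 1))) (hI : I.card ≤ 2) :
    (edgeGraph G ε I).IsAcyclic := by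
  classical
  intro u w hw
  have hsub : w.edges.toFinset ⊆ I.image fun i => (ε i : Sym2 W) := by
    intro e he
    have := w.edges_subset_edgeSet (List.mem_toFinset.1 he)
    rw [edgeSet_edgeGraph] at this
    simpa using this
  have h1 := (card_le_card hsub).trans card_image_le
  rw [List.toFinset_card_of_nodup hw.edges_nodup, SimpleGraph.Walk.length_edges] at h1
  have := hw.three_le_length
  omega

/-- Every tree contained in `G` and containing `I` comes from a basis. -/
lemma MatroidData.exists_basis_between (hM : MatroidData d n k W G ε Bs)
    {I J : Finset (Fin (d + 1))} (hIJ : I ⊆ J) (hI : I.card ≤ 2)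
    (hJ : (edgeGraph G ε J).Connected) : ∃ l, I ⊆ Bs l ∧ Bs l ⊆ J := by
  classical
  have hle : edgeGraph G ε I ≤ edgeGraph G ε J := by
    rw [← SimpleGraph.edgeSet_subset_edgeSet, edgeSet_edgeGraph, edgeSet_edgeGraph]
    exact Set.image_mono (by exact_mod_cast hIJ)
  obtain ⟨F, hIF, hFJ, hF⟩ :=
    hJ.exists_isTree_le_of_le_of_isAcyclic hle (isAcyclic_edgeGraph I hI)
  rw [← SimpleGraph.edgeSet_subset_edgeSet, edgeSet_edgeGraph] at hIF hFJ
  have hinj : Function.Injective fun i => (ε i : Sym2 W) :=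
    Subtype.val_injective.comp ε.injective
  have hB : edgeGraph G ε (univ.filter fun i => (ε i : Sym2 W) ∈ F.edgeSet) = F := by
    rw [← SimpleGraph.edgeSet_inj, edgeSet_edgeGraph]
    ext e
    constructor
    · rintro ⟨i, hi, rfl⟩
      simpa using hi
    · intro he
      obtain ⟨i, -, rfl⟩ := hFJ he
      exact ⟨i, by simpa using he, rfl⟩
  obtain ⟨l, hl⟩ := hM.all _ (by rw [IsSpanningTreeEdges, hB]; exact hF)
  refine ⟨l, fun i hi => ?_, fun i hi => ?_⟩
  · rw [hl, mem_filter]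
    exact ⟨mem_univ i, hIF ⟨i, hi, rfl⟩⟩
  · rw [hl, mem_filter] at hi
    obtain ⟨j, hj, hji⟩ := hFJ hi.2
    exact hinj hji ▸ hj

lemma MatroidData.exists_basis_insert (hM : MatroidData d n k W G ε Bs) (m : Fin n)
    {I : Finset (Fin (d + 1))} (hI : I.card ≤ 2) : ∃ l, I ⊆ Bs l ∧ Bs l ⊆ I ∪ Bs m := by
  refine hM.exists_basis_between subset_union_left hI ((hM.tree m).connected.mono ?_)
  rw [← SimpleGraph.edgeSet_subset_edgeSet, edgeSet_edgeGraph, edgeSet_edgeGraph]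
  exact Set.image_mono (by exact_mod_cast subset_union_right)

lemma edgeGraph_univ : edgeGraph G ε univ = G := by
  rw [← SimpleGraph.edgeSet_inj, edgeSet_edgeGraph]
  ext e
  constructor
  · rintro ⟨i, -, rfl⟩
    exact (ε i).2
  · intro he
    exact ⟨ε.symm ⟨e, he⟩, by simp, by simp⟩

lemma MatroidData.one_le (hM : MatroidData d n k W G ε Bs) : 1 ≤ d := by
  by_contra hd
  have hac := isAcyclic_edgeGraph (G := G) (ε := ε) univ (by rw [card_univ, Fintype.card_fin]; omega)
  rw [edgeGraph_univ] at hac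
  exact hM.bridgeless 0 (SimpleGraph.isAcyclic_iff_forall_isBridge.1 hac (ε 0).2)

lemma MatroidData.two_le_rank (hM : MatroidData d n k W G ε Bs) : 2 ≤ k := by
  have h01 : (0 : Fin (d + 1)) ≠ ⟨1, by have := hM.one_le; omega⟩ := by
    simp [Fin.ext_iff]
  have hcard := card_pair h01
  obtain ⟨l, hl, -⟩ := hM.exists_basis_between (subset_univ _) hcard.le
    (by rw [edgeGraph_univ]; exact hM.connected)
  rw [← hM.card l, ← hcard]
  exact card_le_card hl

lemma MatroidData.basis_nonempty (hM : MatroidData d n k W G ε Bs) (l : Fin n) :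
    (Bs l).Nonempty := by
  rw [← card_pos, hM.card l]
  exact two_pos.trans_le hM.two_le_rank

/-- The complement of the image of a valid sequence of length `d + 1 - k` is a basis. -/
lemma MatroidData.notMem_range_iff (hM : MatroidData d n k W G ε Bs)
    {σ : Fin (d + 1 - k) → Fin (d + 1)} (hσ : Function.Injective σ) {m : Fin n}
    (hm : ∀ t, σ t ∉ Bs m) (j : Fin (d + 1)) : j ∉ Set.range σ ↔ j ∈ Bs m := by
  have hk : k ≤ d + 1 := by
    simpa [hM.card m] using card_le_univ (Bs m)
  have hsub : univ.image σ ⊆ (Bs m)ᶜ := by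
    intro j hj
    obtain ⟨t, -, rfl⟩ := mem_image.1 hj
    exact mem_compl.2 (hm t)
  have heq : univ.image σ = (Bs m)ᶜ := by
    refine eq_of_subset_of_card_le hsub ?_
    rw [card_compl, card_image_of_injective _ hσ, hM.card m]
    simp
  rw [← not_iff_not, not_not, ← mem_compl, ← heq]
  simp

end Bases

/-! ### The bounded cells of the tropical matroid polytope -/

section Polytope

variable {k : ℕ} {W : Type} {G : SimpleGraph W} {ε : Fin (d + 1) ≃ G.edgeSet}
  {Bs : Fin n → Finset (Fin (d + 1))} {x p : Fin (d + 1) → ℝ}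

lemma gen_of_mem {l : Fin n} {j : Fin (d + 1)} (h : j ∈ Bs l) : gen Bs l j = 0 := if_pos h

lemma gen_of_notMem {l : Fin n} {j : Fin (d + 1)} (h : j ∉ Bs l) : gen Bs l j = 1 := if_neg h

lemma mem_typeEntry_gen_of_mem {l : Fin n} {a : Fin (d + 1)} (ha : a ∈ Bs l) :
    l ∈ typeEntry (gen Bs) x a ↔
      (∀ j ∈ Bs l, x j ≤ x a) ∧ ∀ j ∉ Bs l, x j ≤ x a + 1 := by
  rw [mem_typeEntry_iff, gen_of_mem ha]
  constructor
  · refine fun h => ⟨fun j hj => ?_, fun j hj => ?_⟩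
    · have := h j
      rw [gen_of_mem hj] at this
      linarith
    · have := h j
      rw [gen_of_notMem hj] at this
      linarith
  · rintro ⟨h1, h2⟩ j
    by_cases hj : j ∈ Bs l
    · rw [gen_of_mem hj]
      linarith [h1 j hj]
    · rw [gen_of_notMem hj]
      linarith [h2 j hj]

/-- An element outside a basis `Bs l` whose type entry contains `l` exceeds all
coordinates in `Bs l` by at least one. -/
lemma add_one_le_of_mem_typeEntry_gen {l : Fin n} {a j : Fin (d + 1)} (ha : a ∉ Bs l)
    (hl : l ∈ typeEntry (gen Bs) x a) (hj : j ∈ Bs l) : x j + 1 ≤ x a := by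
  have := mem_typeEntry_iff.1 hl j
  rw [gen_of_mem hj, gen_of_notMem ha] at this
  linarith

/-- The chain simplex of a valid sequence is the cell of its generic point. -/
lemma MatroidData.closedCell_chainPoint (hM : MatroidData d n k W G ε Bs)
    {σ : Fin (d + 1 - k) → Fin (d + 1)} (hσ : Function.Injective σ) {m : Fin n}
    (hm : ∀ t, σ t ∉ Bs m) : closedCell (gen Bs) (chainPoint σ) = chainSimplex σ := by
  have hmem := hM.notMem_range_iff hσ hm
  have hq0 : ∀ j ∈ Bs m, chainPoint σ j = 0 := fun j hj =>
    chainPoint_of_notMem ((hmem j).2 hj)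
  apply Set.Subset.antisymm
  · intro x hx
    have hbase : ∀ b ∈ Bs m, (∀ j ∈ Bs m, x j ≤ x b) ∧ ∀ j ∉ Bs m, x j ≤ x b + 1 := by
      intro b hb
      refine (mem_typeEntry_gen_of_mem hb).1 (hx b ((mem_typeEntry_gen_of_mem hb).2 ⟨?_, ?_⟩))
      · intro j hj
        rw [hq0 j hj, hq0 b hb]
      · intro j _
        rw [hq0 b hb]
        linarith [chainPoint_lt_one hσ j]
    have hpair : ∀ i j, chainPoint σ j ≤ chainPoint σ i → ∃ l, i ∈ Bs l ∧ j ∈ Bs l ∧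
        Bs l ⊆ {i, j} ∪ Bs m ∧ ∀ a ∈ Bs l, x a ≤ x i := by
      intro i j hji
      obtain ⟨l, hl, hl'⟩ := hM.exists_basis_insert m (card_le_two (a := i) (b := j))
      have hi : i ∈ Bs l := hl (by simp)
      refine ⟨l, hi, hl (by simp), hl', ?_⟩
      refine ((mem_typeEntry_gen_of_mem hi).1
        (hx i ((mem_typeEntry_gen_of_mem hi).2 ⟨fun a ha => ?_, fun a _ => ?_⟩))).1
      · rcases mem_union.1 (hl' ha) with ha | ha
        · rcases mem_insert.1 ha with rfl | ha
          · exact le_rfl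
          · rwa [mem_singleton.1 ha]
        · rw [hq0 a ha]
          exact chainPoint_nonneg hσ i
      · linarith [chainPoint_lt_one hσ a, chainPoint_nonneg hσ i]
    obtain ⟨b, hb⟩ := hM.basis_nonempty m
    refine ⟨x b, fun j hj => ?_, fun t => ⟨?_, (hbase b hb).2 _ (hm t)⟩, fun s t hst => ?_⟩
    · have hj := (hmem j).1 hj
      exact le_antisymm ((hbase b hb).1 j hj) ((hbase j hj).1 b hb)
    · obtain ⟨l, -, -, hl, hle⟩ := hpair (σ t) (σ t) le_rfl
      obtain ⟨a, ha, hat⟩ := exists_mem_ne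
        (s := Bs l) (by rw [hM.card l]; exact hM.two_le_rank) (σ t)
      have ham : a ∈ Bs m := by simpa [hat] using hl ha
      exact ((hbase a ham).1 b hb).trans (hle a ha)
    · obtain ⟨l, -, htl, -, hle⟩ := hpair (σ s) (σ t) ((chainPoint_strictAnti hσ).antitone hst)
      exact hle _ htl
  · rintro x ⟨c, hout, hin, hanti⟩ a l hl
    have hc : ∀ j, c ≤ x j ∧ x j ≤ c + 1 := by
      intro j
      by_cases hj : j ∈ Set.range σ
      · obtain ⟨t, rfl⟩ := hj
        exact hin t
      · rw [hout j hj]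
        constructor <;> linarith
    have ha : a ∈ Bs l := by
      by_contra ha
      obtain ⟨j, hj⟩ := hM.basis_nonempty l
      have := add_one_le_of_mem_typeEntry_gen ha hl hj
      linarith [chainPoint_lt_one hσ a, chainPoint_nonneg hσ j]
    rw [mem_typeEntry_gen_of_mem ha] at hl ⊢
    refine ⟨fun j hj => ?_, fun j _ => by linarith [(hc j).2, (hc a).1]⟩
    have hja := hl.1 j hj
    by_cases hjr : j ∈ Set.range σ
    · obtain ⟨s, rfl⟩ := hjr
      by_cases har : a ∈ Set.range σ
      · obtain ⟨t, rfl⟩ := har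
        exact hanti ((chainPoint_strictAnti hσ).le_iff_ge.1 hja)
      · rw [chainPoint_of_notMem har] at hja
        exact absurd hja (chainPoint_pos hσ s).not_ge
    · rw [hout j hjr]
      exact (hc a).1

/-- Every point without empty type entries lies in the chain simplex of a valid sequence. -/
lemma MatroidData.exists_mem_chainSimplex (hM : MatroidData d n k W G ε Bs)
    (hp : ∀ a, (typeEntry (gen Bs) p a).Nonempty) :
    ∃ σ : Fin (d + 1 - k) → Fin (d + 1), Function.Injective σ ∧
      (∃ m : Fin n, ∀ t, σ t ∉ Bs m) ∧ p ∈ chainSimplex σ := by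
  obtain ⟨a, hmin⟩ := Finite.exists_min p
  obtain ⟨l, hl⟩ := hp a
  have ha : a ∈ Bs l := by
    by_contra ha
    obtain ⟨j, hj⟩ := hM.basis_nonempty l
    have := add_one_le_of_mem_typeEntry_gen ha hl hj
    linarith [hmin j]
  rw [mem_typeEntry_gen_of_mem ha] at hl
  have hcard : (Bs l)ᶜ.card = d + 1 - k := by
    rw [card_compl, hM.card l, Fintype.card_fin]
  let e : Fin (d + 1 - k) ≃ {x // x ∈ (Bs l)ᶜ} := ((Bs l)ᶜ.equivFinOfCardEq hcard).symm
  let π := Tuple.sort fun t => -p (e t)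
  let σ : Fin (d + 1 - k) → Fin (d + 1) := fun t => e (π t)
  have hσ : Function.Injective σ :=
    Subtype.val_injective.comp (e.injective.comp π.injective)
  have hm : ∀ t, σ t ∉ Bs l := fun t => mem_compl.1 (e (π t)).2
  refine ⟨σ, hσ, ⟨l, hm⟩, p a, fun j hj => ?_, fun t => ⟨hmin _, hl.2 _ (hm t)⟩,
    fun s t hst => ?_⟩
  · exact le_antisymm (hl.1 j ((hM.notMem_range_iff hσ hm j).1 hj)) (hmin j)
  · exact neg_le_neg_iff.1 (Tuple.monotone_sort (fun t => -p (e t)) hst)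

lemma MatroidData.isBoundedCell_chainSimplex (hM : MatroidData d n k W G ε Bs)
    {σ : Fin (d + 1 - k) → Fin (d + 1)} (hσ : Function.Injective σ) {m : Fin n}
    (hm : ∀ t, σ t ∉ Bs m) : IsBoundedCell (gen Bs) (chainSimplex σ) :=
  ⟨⟨_, (hM.closedCell_chainPoint hσ hm).symm⟩, isBounded_chart_chainSimplex⟩

/-- Every bounded cell lies in the chain simplex of a valid sequence. -/
lemma MatroidData.exists_subset_chainSimplex (hM : MatroidData d n k W G ε Bs)
    {X : Set (Fin (d + 1) → ℝ)} (hX : IsBoundedCell (gen Bs) X) :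
    ∃ σ : Fin (d + 1 - k) → Fin (d + 1), Function.Injective σ ∧
      (∃ m : Fin n, ∀ t, σ t ∉ Bs m) ∧ X ⊆ chainSimplex σ := by
  obtain ⟨⟨p, rfl⟩, hb⟩ := hX
  obtain ⟨σ, hσ, ⟨m, hm⟩, hp⟩ :=
    hM.exists_mem_chainSimplex (typeEntry_nonempty_of_isBounded hM.one_le hb)
  refine ⟨σ, hσ, ⟨m, hm⟩, ?_⟩
  rw [← hM.closedCell_chainPoint hσ hm] at hp ⊢
  exact closedCell_subset_of_mem hp

lemma MatroidData.exists_notMem_range (hM : MatroidData d n k W G ε Bs)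
    {σ : Fin (d + 1 - k) → Fin (d + 1)} (hσ : Function.Injective σ) {m : Fin n}
    (hm : ∀ t, σ t ∉ Bs m) : ∃ j, j ∉ Set.range σ :=
  (hM.basis_nonempty m).imp fun j hj => (hM.notMem_range_iff hσ hm j).2 hj

lemma MatroidData.isMaxBoundedCell_iff (hM : MatroidData d n k W G ε Bs)
    (X : Set (Fin (d + 1) → ℝ)) :
    IsMaxBoundedCell (gen Bs) X ↔
      ∃ σ : Fin (d + 1 - k) → Fin (d + 1), Function.Injective σ ∧
        (∃ m : Fin n, ∀ t, σ t ∉ Bs m) ∧ X = chainSimplex σ := by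
  constructor
  · rintro ⟨hX, hmax⟩
    obtain ⟨σ, hσ, ⟨m, hm⟩, hsub⟩ := hM.exists_subset_chainSimplex hX
    exact ⟨σ, hσ, ⟨m, hm⟩, (hmax _ (hM.isBoundedCell_chainSimplex hσ hm) hsub).symm⟩
  · rintro ⟨σ, hσ, ⟨m, hm⟩, rfl⟩
    refine ⟨hM.isBoundedCell_chainSimplex hσ hm, fun Y hY hsub => ?_⟩
    obtain ⟨τ, hτ, ⟨m', hm'⟩, hYτ⟩ := hM.exists_subset_chainSimplex hY
    obtain rfl := eq_of_chainPoint_mem hσ hτ (hM.exists_notMem_range hτ hm')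
      (hYτ (hsub (chainPoint_mem_chainSimplex hσ)))
    exact hYτ.antisymm hsub

end Polytope

/-- The inclusion-maximal bounded cells of the tropical complex of the
tropical matroid polytope are exactly the tropical convex hulls
`tconv{0, e_{i₁}, e_{i₁,i₂}, …, e_{i₁,…,i_{d-k+1}}}` of the pseudovertices of the valid
sequences `i₁, …, i_{d-k+1}` of length `d-k+1` (so that the complement of
`{i₁,…,i_{d-k+1}}` is a basis), and each such cell has dimension `d-k+1`. -/
theorem maxBoundedCells_tropicalMatroidPolytope
    (d n k : ℕ) (W : Type) [Fintype W] (G : SimpleGraph W)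
    (ε : Fin (d + 1) ≃ G.edgeSet) (Bs : Fin n → Finset (Fin (d + 1)))
    (hM : MatroidData d n k W G ε Bs) :
    (∀ X : Set (Fin (d + 1) → ℝ),
      IsMaxBoundedCell (gen Bs) X ↔
        ∃ σ : Fin (d + 1 - k) → Fin (d + 1), Function.Injective σ ∧
          (∃ m : Fin n, ∀ t, σ t ∉ Bs m) ∧
          X = {x | InTconv (fun s : Fin (d + 1 - k + 1) => ptSeq σ (s : ℕ)) x}) ∧
    (∀ X : Set (Fin (d + 1) → ℝ),
      IsMaxBoundedCell (gen Bs) X →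
        Module.finrank ℝ (vectorSpan ℝ (chart '' X)) = d + 1 - k) := by
  refine ⟨fun X => ?_, fun X hX => ?_⟩
  · rw [hM.isMaxBoundedCell_iff]
    refine exists_congr fun σ => and_congr_right fun hσ => ?_
    rw [setOf_inTconv_ptSeq hσ]
  · obtain ⟨σ, hσ, ⟨m, hm⟩, rfl⟩ := (hM.isMaxBoundedCell_iff X).1 hX
    exact finrank_vectorSpan_chart_chainSimplex hσ (hM.exists_notMem_range hσ hm)
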